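/- Let 1 < α ≤ 2 and β₁ = β₂ = 1/(α−1). Then the doubly-indexed limit, as n → ∞ and m → ∞ (along the product filter), of ρ(n,m)/(n^{−β₁} m^{−β₂} ln(n) ln(m)) exists and equals 1. -/

import Mathlib

open Filter MeasureTheory Real Set

/-- The kernel `V(x,y) = xy/(x^2+y^2)^{(2-α)/2}` with `V(0,0)=0`. -/
noncomputable def V (α : ℝ) : ℝ → ℝ → ℝ := fun x y =>
  if x = 0 ∧ y = 0 then 0 else x * y / (x ^ 2 + y ^ 2) ^ ((2 - α) / 2)

open Topology

noncomputable def gg (β : ℝ) (n i : ℕ) : ℝ := (1 + (i:ℝ))⁻¹ * ((n:ℝ) / (1 + i + n)) ^ β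

lemma gg_nonneg (β : ℝ) (n i : ℕ) : 0 ≤ gg β n i := by unfold gg; positivity

lemma frac_pow_le {β : ℝ} (hβ : 1 ≤ β) (n i : ℕ) :
    ((n:ℝ) / (1 + i + n)) ^ β ≤ (n:ℝ) / (1 + i + n) := by
  apply Real.rpow_le_self_of_le_one (by positivity) _ hβ
  rw [div_le_one (by positivity)]
  have : (0:ℝ) ≤ i := by positivity
  linarith

lemma gg_le {β : ℝ} (hβ : 1 ≤ β) (n i : ℕ) :
    gg β n i ≤ (1 + (i:ℝ))⁻¹ * ((n:ℝ) / (1 + i + n)) := by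
  unfold gg
  gcongr
  exact frac_pow_le hβ n i

lemma gg_le_one {β : ℝ} (hβ : 1 ≤ β) (n i : ℕ) : gg β n i ≤ 1 := by
  refine (gg_le hβ n i).trans ?_
  have h0 : (0:ℝ) ≤ i := by positivity
  have h1 : (1 + (i:ℝ))⁻¹ ≤ 1 := inv_le_one_of_one_le₀ (by linarith)
  have h2 : (n:ℝ) / (1 + i + n) ≤ 1 := by
    rw [div_le_one (by positivity)]
    have : (0:ℝ) ≤ i := by positivity
    linarith
  exact mul_le_one₀ h1 (by positivity) h2

lemma harm_cast (n : ℕ) : ((harmonic n : ℚ) : ℝ) = ∑ i ∈ Finset.range n, (1 + (i:ℝ))⁻¹ := by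
  simp [harmonic, add_comm]

lemma partial_tel (n N : ℕ) : ∑ i ∈ Finset.range N, (1 + (i:ℝ))⁻¹ * ((n:ℝ) / (1 + i + n))
    ≤ ∑ i ∈ Finset.range n, (1 + (i:ℝ))⁻¹ := by
  have e : ∀ i : ℕ, (1 + (i:ℝ))⁻¹ * ((n:ℝ) / (1 + i + n)) = (1 + (i:ℝ))⁻¹ - (1 + ((n + i : ℕ):ℝ))⁻¹ := by
    intro i
    have : (1 + (i:ℝ)) ≠ 0 := by positivity
    have : (1 + (i:ℝ) + n) ≠ 0 := by positivity
    have h3 : (1 + ((n + i : ℕ):ℝ)) = 1 + i + n := by push_cast; ring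
    rw [h3]
    field_simp
    ring
  rw [Finset.sum_congr rfl (fun i _ => e i), Finset.sum_sub_distrib]
  have h1 := Finset.sum_range_add (fun i : ℕ => (1 + (i:ℝ))⁻¹) n N
  have h2 : ∑ i ∈ Finset.range N, (1 + (i:ℝ))⁻¹ ≤ ∑ i ∈ Finset.range (n + N), (1 + (i:ℝ))⁻¹ := by
    apply Finset.sum_le_sum_of_subset_of_nonneg
    · intro x; simp; omega
    · intros; positivity
  linarith

lemma gg_summable {β : ℝ} (hβ : 1 ≤ β) (n : ℕ) : Summable (gg β n) := by
  apply summable_of_sum_range_le (c := ∑ i ∈ Finset.range n, (1 + (i:ℝ))⁻¹) (gg_nonneg β n)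
  intro N
  exact (Finset.sum_le_sum (fun i _ => gg_le hβ n i)).trans (partial_tel n N)

noncomputable def GG (β : ℝ) (n : ℕ) : ℝ := ∑' i, gg β n i

lemma GG_nonneg (β : ℝ) (n : ℕ) : 0 ≤ GG β n := tsum_nonneg (gg_nonneg β n)

lemma GG_le {β : ℝ} (hβ : 1 ≤ β) (n : ℕ) : GG β n ≤ 1 + Real.log n := by
  refine le_trans ?_ (harmonic_le_one_add_log n)
  rw [harm_cast]
  apply Real.tsum_le_of_sum_range_le (gg_nonneg β n)
  intro N
  exact (Finset.sum_le_sum (fun i _ => gg_le hβ n i)).trans (partial_tel n N)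

lemma le_GG {β : ℝ} (hβ : 1 ≤ β) (n : ℕ) (hn : 1 ≤ n) : Real.log n - β ≤ GG β n := by
  have h1 : ∑ i ∈ Finset.range n, gg β n i ≤ GG β n :=
    (gg_summable hβ n).sum_le_tsum _ (fun i _ => gg_nonneg β n i)
  have hn' : (0:ℝ) < n := by exact_mod_cast hn
  have h2 : ∀ i ∈ Finset.range n, (1 + (i:ℝ))⁻¹ - β / n ≤ gg β n i := by
    intro i hi
    have hp : (0:ℝ) < 1 + i := by positivity
    have hb := one_add_mul_self_le_rpow_one_add (s := -((1+i:ℝ)/(1+i+n))) (by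
      rw [neg_le_neg_iff, div_le_one (by positivity)]; linarith) hβ
    have e : 1 + -((1+i:ℝ)/(1+i+n)) = n / (1+i+n) := by field_simp; ring
    rw [e] at hb
    have : (1 + (i:ℝ))⁻¹ * (1 + β * -((1+i:ℝ)/(1+i+n))) ≤ gg β n i := by
      unfold gg; gcongr
    refine le_trans ?_ this
    have e2 : (1 + (i:ℝ))⁻¹ * (1 + β * -((1+i:ℝ)/(1+i+n))) = (1 + (i:ℝ))⁻¹ - β / (1+i+n) := by
      field_simp; ring
    rw [e2]
    gcongr
    linarith
  have h3 := Finset.sum_le_sum h2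
  rw [Finset.sum_sub_distrib, ← harm_cast] at h3
  simp only [Finset.sum_const, Finset.card_range, nsmul_eq_mul] at h3
  rw [mul_div_cancel₀ _ hn'.ne'] at h3
  have h4 := log_add_one_le_harmonic n
  have h5 : Real.log n ≤ Real.log (n + 1 : ℕ) := Real.log_le_log hn' (by push_cast; linarith)
  linarith

lemma tail_le {β : ℝ} (hβ : 1 ≤ β) (n : ℕ) :
    Summable (fun i : ℕ => gg β n i * ((1+i:ℝ)/(1+i+n))) ∧
    ∑' i : ℕ, gg β n i * ((1+i:ℝ)/(1+i+n)) ≤ 1 := by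
  have key : ∀ N : ℕ, ∑ i ∈ Finset.range N, gg β n i * ((1+i:ℝ)/(1+i+n)) ≤ 1 := by
    intro N
    rcases Nat.eq_zero_or_pos n with h0 | hn
    · have : ∀ i ∈ Finset.range N, gg β n i * ((1+i:ℝ)/(1+i+n)) = 0 := by
        intro i _
        have : β ≠ 0 := by linarith
        simp [gg, h0, Real.zero_rpow this]
      rw [Finset.sum_congr rfl this]; simp
    have hn' : (0:ℝ) < n := by exact_mod_cast hn
    have : ∑ i ∈ Finset.range N, gg β n i * ((1+i:ℝ)/(1+i+n)) ≤ 1 - n / (N + n) := by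
      induction N with
      | zero => simp [hn'.ne']
      | succ k ih =>
        rw [Finset.sum_range_succ]
        have hb : gg β n k * ((1+k:ℝ)/(1+k+n)) ≤ (1 + (k:ℝ))⁻¹ * ((n:ℝ) / (1 + k + n)) * ((1+k:ℝ)/(1+k+n)) := by
          gcongr; exact gg_le hβ n k
        have : (1 + (k:ℝ))⁻¹ * ((n:ℝ) / (1 + k + n)) * ((1+k:ℝ)/(1+k+n)) ≤ n / (k+n) - n / ((k+1:ℕ) + n) := by
          push_cast
          have e : (1 + (k:ℝ))⁻¹ * ((n:ℝ) / (1 + k + n)) * ((1+k:ℝ)/(1+k+n)) = n / ((1+k+n)*(1+k+n)) := by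
            field_simp
          have e2 : (n:ℝ) / (k+n) - n / (k+1 + n) = n / ((k+n)*(1+k+n)) := by
            field_simp; ring
          rw [e, e2]
          gcongr
          linarith
        linarith
    have : (0:ℝ) ≤ n / (N+n) := by positivity
    linarith
  have hnn : ∀ i : ℕ, 0 ≤ gg β n i * ((1+i:ℝ)/(1+i+n)) := fun i =>
    mul_nonneg (gg_nonneg β n i) (by positivity)
  exact ⟨summable_of_sum_range_le hnn key, Real.tsum_le_of_sum_range_le hnn key⟩

lemma GG_tendsto {β : ℝ} (hβ : 1 ≤ β) :
    Tendsto (fun n : ℕ => GG β n / Real.log n) atTop (𝓝 1) := by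
  have hl : Tendsto (fun n : ℕ => (Real.log n)⁻¹) atTop (𝓝 0) :=
    (Real.tendsto_log_atTop.comp tendsto_natCast_atTop_atTop).inv_tendsto_atTop
  have h1 : Tendsto (fun n : ℕ => 1 - β * (Real.log n)⁻¹) atTop (𝓝 1) := by
    simpa using (hl.const_mul β).const_sub 1
  have h2 : Tendsto (fun n : ℕ => 1 + (Real.log n)⁻¹) atTop (𝓝 1) := by
    simpa using hl.const_add 1
  refine tendsto_of_tendsto_of_tendsto_of_le_of_le' h1 h2 ?_ ?_
  · filter_upwards [eventually_ge_atTop 2] with n hn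
    have : 0 < Real.log n := Real.log_pos (by exact_mod_cast hn)
    rw [le_div_iff₀ this]
    have := le_GG hβ n (by omega)
    field_simp
    linarith
  · filter_upwards [eventually_ge_atTop 2] with n hn
    have : 0 < Real.log n := Real.log_pos (by exact_mod_cast hn)
    rw [div_le_iff₀ this]
    have := GG_le hβ n
    field_simp
    linarith

lemma bdd_aux (v : ℕ → ℕ → ℝ) (N : ℕ) (B : ℝ) (h : ∀ i j, N ≤ i → N ≤ j → v i j ≤ B)
    (hr : ∀ i, ∃ C, ∀ j, v i j ≤ C) (hcl : ∀ j, ∃ C, ∀ i, v i j ≤ C) : ∃ C, 0 < C ∧ ∀ i j, v i j ≤ C := by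
  choose R hR using hr
  choose S hS using hcl
  have hs : ∀ (f : ℕ → ℝ) i, i < N → f i ≤ ∑ k ∈ Finset.range N, |f k| := fun f i hi =>
    (le_abs_self _).trans (Finset.single_le_sum (f := fun k => |f k|) (fun k _ => abs_nonneg _) (Finset.mem_range.2 hi))
  have p1 : 0 ≤ ∑ k ∈ Finset.range N, |R k| := Finset.sum_nonneg (fun _ _ => abs_nonneg _)
  have p2 : 0 ≤ ∑ k ∈ Finset.range N, |S k| := Finset.sum_nonneg (fun _ _ => abs_nonneg _)
  have p3 := abs_nonneg B
  have p4 := le_abs_self B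
  refine ⟨1 + |B| + ∑ k ∈ Finset.range N, |R k| + ∑ k ∈ Finset.range N, |S k|, by linarith, ?_⟩
  intro i j
  by_cases hi : i < N
  · have := hs R i hi
    linarith [hR i j]
  by_cases hj : j < N
  · have := hs S j hj
    linarith [hS j i]
  linarith [h i j (by omega) (by omega)]

lemma w_bdd (w : ℕ → ℕ → ℝ)
    (hA1 : Tendsto (fun p : ℕ × ℕ => w p.1 p.2) (atTop ×ˢ atTop) (nhds 1))
    (winf : ℕ → ℝ) (hA2 : ∀ i, Tendsto (fun j => w i j) atTop (nhds (winf i)))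
    (wco : ℕ → ℝ) (hA3 : ∀ j, Tendsto (fun i => w i j) atTop (nhds (wco j))) :
    ∃ C, 0 < C ∧ ∀ i j, |w i j| ≤ C := by
  have h1 : ∀ᶠ p : ℕ × ℕ in atTop ×ˢ atTop, |w p.1 p.2| < 2 :=
    hA1.abs.eventually_lt_const (by norm_num)
  rw [prod_atTop_atTop_eq, eventually_atTop] at h1
  obtain ⟨⟨N1, N2⟩, hN⟩ := h1
  refine bdd_aux (fun i j => |w i j|) (max N1 N2) 2 ?_ ?_ ?_
  · intro i j hi hj
    exact (hN (i, j) ⟨(le_max_left _ _).trans hi, (le_max_right _ _).trans hj⟩).le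
  · intro i
    obtain ⟨C, hC⟩ := (hA2 i).abs.bddAbove_range
    exact ⟨C, fun j => hC ⟨j, rfl⟩⟩
  · intro i
    obtain ⟨C, hC⟩ := (hA3 i).abs.bddAbove_range
    exact ⟨C, fun j => hC ⟨j, rfl⟩⟩

/-- factorization -/
lemma V_factor (α β : ℝ) (hα : 1 < α) (hβ : β = 1 / (α - 1)) (u v : ℝ) (hu : u ≠ 0)
    (a b a' b' : ℝ) (ha : 0 < a) (hb : 0 < b) (ha' : 0 < a') (hb' : 0 < b') :
    V α (u * a ^ (-β) * b ^ (-β)) (v * a' ^ (-β) * b' ^ (-β)) =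
      a⁻¹ * b⁻¹ * a' ^ (-β) * b' ^ (-β) *
       ((u * |u| ^ (α - 2) * v) * (1 + (v / u) ^ 2 * ((a / a') ^ β * (b / b') ^ β) ^ 2) ^ (-((2 - α) / 2))) := by
  have hα' : α - 1 ≠ 0 := by linarith
  have hx : u * a ^ (-β) * b ^ (-β) ≠ 0 := by positivity
  have pa : ∀ t : ℝ, 0 < t → t ^ (-β) * (t ^ (-β)) ^ (α - 2) = t⁻¹ := by
    intro t ht
    rw [← Real.rpow_mul ht.le, ← Real.rpow_add ht, ← Real.rpow_neg_one t]
    congr 1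
    rw [hβ]; field_simp; ring
  unfold V
  rw [if_neg (by tauto)]
  set θ := (2 - α) / 2 with hθ
  have hr : (u * a ^ (-β) * b ^ (-β)) ^ 2 + (v * a' ^ (-β) * b' ^ (-β)) ^ 2 =
      (u * a ^ (-β) * b ^ (-β)) ^ 2 * (1 + (v / u) ^ 2 * ((a / a') ^ β * (b / b') ^ β) ^ 2) := by
    rw [Real.div_rpow ha.le ha'.le, Real.div_rpow hb.le hb'.le, Real.rpow_neg ha.le, Real.rpow_neg hb.le,
      Real.rpow_neg ha'.le, Real.rpow_neg hb'.le]
    have := (Real.rpow_pos_of_pos ha β).ne'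
    have := (Real.rpow_pos_of_pos hb β).ne'
    have := (Real.rpow_pos_of_pos ha' β).ne'
    have := (Real.rpow_pos_of_pos hb' β).ne'
    field_simp
  have hpos : 0 < 1 + (v / u) ^ 2 * ((a / a') ^ β * (b / b') ^ β) ^ 2 := by positivity
  rw [hr, Real.mul_rpow (by positivity) hpos.le, div_eq_mul_inv, mul_inv, ← Real.rpow_neg (by positivity),
    ← Real.rpow_neg hpos.le]
  have h3 : ((u * a ^ (-β) * b ^ (-β)) ^ 2) ^ (-θ) = |u| ^ (α - 2) * (a ^ (-β)) ^ (α - 2) * (b ^ (-β)) ^ (α - 2) := by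
    rw [← sq_abs, ← Real.rpow_natCast, ← Real.rpow_mul (abs_nonneg _), abs_mul, abs_mul,
      abs_of_pos (Real.rpow_pos_of_pos ha _), abs_of_pos (Real.rpow_pos_of_pos hb _),
      Real.mul_rpow (by positivity) (by positivity), Real.mul_rpow (by positivity) (by positivity)]
    have : ((2:ℕ):ℝ) * -θ = α - 2 := by rw [hθ]; push_cast; ring
    rw [this]
  rw [h3, ← pa a ha, ← pa b hb]
  ring

lemma one_sub_le_rpow {α s : ℝ} (hα : 1 < α) (hα2 : α ≤ 2) (hs : 0 ≤ s) :
    1 - s ≤ (1 + s) ^ (-((2 - α) / 2)) ∧ (1 + s) ^ (-((2 - α) / 2)) ≤ 1 := by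
  constructor
  · have h1 : (1 + s) ^ (-1 : ℝ) ≤ (1 + s) ^ (-((2 - α) / 2)) :=
      Real.rpow_le_rpow_of_exponent_le (by linarith) (by linarith)
    refine le_trans ?_ h1
    rw [Real.rpow_neg_one, ← one_div, le_div_iff₀ (by linarith)]
    nlinarith
  · exact Real.rpow_le_one_of_one_le_of_nonpos (by linarith) (by linarith)

lemma key_bound (α β : ℝ) (hα : 1 < α) (hα2 : α ≤ 2) (hβ : β = 1 / (α - 1)) (hβ1 : 1 ≤ β)
    (w : ℕ → ℕ → ℝ) (hw : ∀ i j, w i j ≠ 0)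
    (hA1 : Tendsto (fun p : ℕ × ℕ => w p.1 p.2) (atTop ×ˢ atTop) (nhds 1))
    (C : ℝ) (hC0 : 0 < C) (hC : ∀ i j, |w i j| ≤ C)
    (D : ℝ) (hD0 : 0 < D) (hD : ∀ i j, |(w i j)⁻¹| ≤ D) (δ : ℝ) (hδ : 0 < δ) :
    ∃ K : ℝ, ∃ N : ℕ, 0 ≤ K ∧ ∀ n m i j : ℕ, 1 ≤ n → 1 ≤ m →
      |(n:ℝ) ^ β * (m:ℝ) ^ β * V α (w i j * (1 + (i : ℝ)) ^ (-β) * (1 + (j : ℝ)) ^ (-β))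
        (w (i+n) (j+m) * (1 + ((i+n : ℕ) : ℝ)) ^ (-β) * (1 + ((j+m:ℕ) : ℝ)) ^ (-β))
        - gg β n i * gg β m j| ≤ gg β n i * gg β m j *
          (δ + K * ((if i < N then 1 else 0) + (if j < N then 1 else 0) + (1+i:ℝ)/(1+i+n))) := by
  -- continuity
  have hcont : Tendsto (fun p : ℝ × ℝ => p.1 * |p.1| ^ (α - 2) * p.2) (𝓝 (1, 1)) (𝓝 1) := by
    have : ContinuousAt (fun p : ℝ × ℝ => p.1 * |p.1| ^ (α - 2) * p.2) (1, 1) := by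
      refine (continuousAt_fst.mul (ContinuousAt.rpow_const ?_ ?_)).mul continuousAt_snd
      · exact continuousAt_fst.abs
      · left; simp
    simpa [ContinuousAt] using this
  obtain ⟨η, hη, hη2⟩ := Metric.tendsto_nhds_nhds.1 hcont δ hδ
  have h1 := Metric.tendsto_nhds.1 hA1 η hη
  rw [prod_atTop_atTop_eq, eventually_atTop] at h1
  obtain ⟨⟨N1, N2⟩, hN⟩ := h1
  set N := max N1 N2
  have hN' : ∀ i j, N ≤ i → N ≤ j → dist (w i j) 1 < η := fun i j hi hj =>
    hN (i, j) ⟨(le_max_left _ _).trans hi, (le_max_right _ _).trans hj⟩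
  set P0 := C ^ (α - 1) * C with hP0
  have hP0p : 0 < P0 := by positivity
  have hP : ∀ i j k l, |w i j * |w i j| ^ (α - 2) * w k l| ≤ P0 := by
    intro i j k l
    have hp : 0 < |w i j| := abs_pos.2 (hw i j)
    rw [abs_mul, abs_mul, abs_of_pos (Real.rpow_pos_of_pos hp _)]
    have : |w i j| * |w i j| ^ (α - 2) = |w i j| ^ (α - 1) := by
      nth_rewrite 1 [← Real.rpow_one |w i j|]
      rw [← Real.rpow_add hp]; congr 1; ring
    rw [this, hP0]
    exact mul_le_mul (Real.rpow_le_rpow hp.le (hC i j) (by linarith)) (hC k l) (abs_nonneg _) (by positivity)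
  refine ⟨P0 + 1 + P0 * (C * D) ^ 2, N, by positivity, ?_⟩
  intro n m i j hn hm
  have hn' : (0:ℝ) < n := by exact_mod_cast hn
  have hm' : (0:ℝ) < m := by exact_mod_cast hm
  rw [V_factor α β hα hβ _ _ (hw i j) _ _ _ _ (by positivity) (by positivity) (by positivity) (by positivity)]
  set P := w i j * |w i j| ^ (α - 2) * w (i+n) (j+m) with hPdef
  set s := (w (i + n) (j + m) / w i j) ^ 2 * (((1 + (i:ℝ)) / (1 + ((i + n : ℕ):ℝ))) ^ β * ((1 + (j:ℝ)) / (1 + ((j + m : ℕ):ℝ))) ^ β) ^ 2 with hs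
  have hs0 : 0 ≤ s := by positivity
  have hsle : s ≤ (C * D) ^ 2 * ((1+i:ℝ)/(1+i+n)) := by
    have q1 : (w (i + n) (j + m) / w i j) ^ 2 ≤ (C * D) ^ 2 := by
      rw [← sq_abs, div_eq_mul_inv, abs_mul]
      gcongr
      · exact hC _ _
      · exact hD _ _
    have e1 : (1 + ((i + n : ℕ):ℝ)) = 1 + i + n := by push_cast; ring
    have q2 : ((1 + (i:ℝ)) / (1 + ((i + n : ℕ):ℝ))) ^ β ≤ (1+i:ℝ)/(1+i+n) := by
      rw [e1]
      apply Real.rpow_le_self_of_le_one (by positivity) _ hβ1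
      rw [div_le_one (by positivity)]; linarith
    have q2' : (1+i:ℝ)/(1+i+n) ≤ 1 := by
      rw [div_le_one (by positivity)]; linarith
    have q3 : ((1 + (j:ℝ)) / (1 + ((j + m : ℕ):ℝ))) ^ β ≤ 1 := by
      apply Real.rpow_le_one (by positivity) _ (by linarith)
      rw [div_le_one (by positivity)]; push_cast; linarith
    have q4 : ((1 + (i:ℝ)) / (1 + ((i + n : ℕ):ℝ))) ^ β * ((1 + (j:ℝ)) / (1 + ((j + m : ℕ):ℝ))) ^ β ≤ (1+i:ℝ)/(1+i+n) := by
      calc _ ≤ (1+i:ℝ)/(1+i+n) * 1 := by gcongr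
        _ = _ := mul_one _
    have q5 : (((1 + (i:ℝ)) / (1 + ((i + n : ℕ):ℝ))) ^ β * ((1 + (j:ℝ)) / (1 + ((j + m : ℕ):ℝ))) ^ β) ^ 2 ≤ (1+i:ℝ)/(1+i+n) := by
      calc _ ≤ ((1+i:ℝ)/(1+i+n)) ^ 2 := by gcongr
        _ ≤ _ := by
          rw [sq]
          exact mul_le_of_le_one_left (by positivity) q2'
    rw [hs]
    gcongr
  obtain ⟨t1, t2⟩ := one_sub_le_rpow hα hα2 hs0
  set t := (1 + s) ^ (-((2 - α) / 2))
  have hPle : |P| ≤ P0 := hP _ _ _ _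
  have hP1 : |P - 1| ≤ δ + (P0 + 1) * ((if i < N then 1 else 0) + (if j < N then 1 else 0)) := by
    have hb : |P - 1| ≤ P0 + 1 := (abs_sub _ _).trans (by simpa using hPle)
    by_cases hi : i < N
    · rw [if_pos hi]
      split_ifs <;> nlinarith
    by_cases hj : j < N
    · rw [if_pos hj, if_neg hi]; nlinarith
    · rw [if_neg hi, if_neg hj]
      have := @hη2 (w i j, w (i+n) (j+m)) (by
        rw [Prod.dist_eq]
        exact max_lt (hN' _ _ (by omega) (by omega)) (hN' _ _ (by omega) (by omega)))
      rw [Real.dist_eq] at this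
      simpa using this.le
  have hF : |P * t - 1| ≤ δ + (P0 + 1 + P0 * (C * D) ^ 2) * ((if i < N then 1 else 0) + (if j < N then 1 else 0) + (1+i:ℝ)/(1+i+n)) := by
    have e : P * t - 1 = (P - 1) - P * (1 - t) := by ring
    have h5 : |P * (1 - t)| ≤ P0 * ((C * D) ^ 2 * ((1+i:ℝ)/(1+i+n))) := by
      rw [abs_mul, abs_of_nonneg (by linarith : 0 ≤ 1 - t)]
      apply mul_le_mul hPle (by linarith) (by linarith) hP0p.le
    have h6 : |P * t - 1| ≤ |P - 1| + |P * (1 - t)| := by rw [e]; exact abs_sub _ _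
    have hI : (0:ℝ) ≤ (if i < N then 1 else 0) + (if j < N then 1 else 0) := by
      split_ifs <;> norm_num
    have hu : 0 ≤ (1+i:ℝ)/(1+i+n) := by positivity
    generalize (if i < N then (1:ℝ) else 0) + (if j < N then 1 else 0) = I at *
    generalize (1+i:ℝ)/(1+i+n) = U at *
    have r1 : 0 ≤ P0 * (C * D) ^ 2 * I := by positivity
    have r2 : 0 ≤ (P0 + 1) * U := by positivity
    nlinarith
  have hg : (n:ℝ) ^ β * (m:ℝ) ^ β * ((1 + (i:ℝ))⁻¹ * (1 + (j:ℝ))⁻¹ * (1 + ((i + n : ℕ):ℝ)) ^ (-β) * (1 + ((j + m : ℕ):ℝ)) ^ (-β)) = gg β n i * gg β m j := by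
    unfold gg
    rw [Real.div_rpow hn'.le (by positivity), Real.div_rpow hm'.le (by positivity), Real.rpow_neg (by positivity),
      Real.rpow_neg (by positivity)]
    push_cast
    rw [← add_assoc, ← add_assoc]
    ring
  rw [← mul_assoc, hg, ← mul_sub_one, abs_mul, abs_of_nonneg (mul_nonneg (gg_nonneg _ _ _) (gg_nonneg _ _ _))]
  exact mul_le_mul_of_nonneg_left hF (mul_nonneg (gg_nonneg _ _ _) (gg_nonneg _ _ _))

lemma sum_bound (β : ℝ) (hβ1 : 1 ≤ β) (δ K : ℝ) (N n m : ℕ) (hδ : 0 < δ) (hK : 0 ≤ K) (f : ℕ × ℕ → ℝ) (hf : Summable f)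
    (h : ∀ i j, |f (i, j) - gg β n i * gg β m j| ≤ gg β n i * gg β m j *
          (δ + K * ((if i < N then 1 else 0) + (if j < N then 1 else 0) + (1+i:ℝ)/(1+i+n)))) :
    |∑' q, f q - GG β n * GG β m| ≤ δ * (GG β n * GG β m) + K * (N * GG β m + N * GG β n + GG β m) := by
  have hn := gg_summable hβ1 n
  have hm := gg_summable hβ1 m
  obtain ⟨ht, ht1⟩ := tail_le hβ1 n
  have mulS : ∀ (a b : ℕ → ℝ), (∀ i, 0 ≤ a i) → (∀ i, 0 ≤ b i) → Summable a → Summable b →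
      HasSum (fun q : ℕ × ℕ => a q.1 * b q.2) ((∑' i, a i) * ∑' i, b i) := by
    intro a b ha hb sa sb
    exact sa.hasSum.mul sb.hasSum (sa.mul_of_nonneg sb ha hb)
  have fin : ∀ k : ℕ, Summable (fun i => gg β k i * (if i < N then (1:ℝ) else 0)) ∧
      ∑' i, gg β k i * (if i < N then (1:ℝ) else 0) ≤ N := by
    intro k
    have hz : ∀ i ∉ Finset.range N, gg β k i * (if i < N then (1:ℝ) else 0) = 0 := by
      intro i hi
      rw [Finset.mem_range] at hi
      simp [hi]
    refine ⟨summable_of_ne_finset_zero hz, ?_⟩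
    rw [tsum_eq_sum hz]
    calc _ ≤ ∑ i ∈ Finset.range N, (1:ℝ) := by
          apply Finset.sum_le_sum
          intro i hi
          rw [if_pos (Finset.mem_range.1 hi), mul_one]
          exact gg_le_one hβ1 k i
      _ = N := by simp
  have hif : ∀ k i, 0 ≤ gg β k i * (if i < N then (1:ℝ) else 0) := by
    intro k i
    have := gg_nonneg β k i
    split_ifs <;> simp [this]
  have S0 := mulS _ _ (gg_nonneg β n) (gg_nonneg β m) hn hm
  have S1 := mulS _ _ (hif n) (gg_nonneg β m) (fin n).1 hm
  have S2 := mulS _ _ (gg_nonneg β n) (hif m) hn (fin m).1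
  have S3 := mulS _ _ (fun i => mul_nonneg (gg_nonneg β n i) (by positivity)) (gg_nonneg β m) ht hm
  have T := (S0.mul_left δ).add (((S1.add S2).add S3).mul_left K)
  have L := hf.hasSum.sub S0
  have hle := L.norm_le_of_bounded T (by
    rintro ⟨i, j⟩
    rw [Real.norm_eq_abs]
    refine (h i j).trans (le_of_eq ?_)
    simp only
    ring)
  refine hle.trans ?_
  have a1 := (fin n).2
  have a2 := (fin m).2
  have b1 := GG_nonneg β n
  have b2 := GG_nonneg β m
  change δ * (GG β n * GG β m) + K * ((_ * GG β m + GG β n * _) + _ * GG β m) ≤ _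
  refine add_le_add le_rfl (mul_le_mul_of_nonneg_left (add_le_add (add_le_add ?_ ?_) ?_) hK)
  · exact mul_le_mul_of_nonneg_right a1 b2
  · rw [mul_comm]; exact mul_le_mul_of_nonneg_right a2 b1
  · exact mul_le_of_le_one_left b2 ht1

theorem stmt5 (α β₁ β₂ : ℝ)
    (hα : 1 < α) (hα2 : α ≤ 2)
    (hβ₁ : β₁ = 1 / (α - 1)) (hβ₂ : β₂ = 1 / (α - 1))
    (w : ℕ → ℕ → ℝ) (hw : ∀ i j, w i j ≠ 0)
    (hA1 : Tendsto (fun p : ℕ × ℕ => w p.1 p.2) (atTop ×ˢ atTop) (nhds 1))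
    (winf : ℕ → ℝ)
    (hA2 : ∀ i, Tendsto (fun j => w i j) atTop (nhds (winf i)) ∧ 0 < winf i)
    (wco : ℕ → ℝ)
    (hA3 : ∀ j, Tendsto (fun i => w i j) atTop (nhds (wco j)) ∧ 0 < wco j)
    (c : ℕ → ℕ → ℝ)
    (hc : ∀ i j, c i j = w i j * (1 + (i : ℝ)) ^ (-β₁) * (1 + (j : ℝ)) ^ (-β₂))
    (ρ : ℕ → ℕ → ℝ)
    (hsum : ∀ n m : ℕ, 1 ≤ n → 1 ≤ m →
      Summable (fun q : ℕ × ℕ => V α (c q.1 q.2) (c (q.1 + n) (q.2 + m))))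
    (hρ : ∀ n m : ℕ, 1 ≤ n → 1 ≤ m →
      ρ n m = ∑' i : ℕ, ∑' j : ℕ, V α (c i j) (c (i + n) (j + m)))
    :
    Tendsto (fun p : ℕ × ℕ => ρ p.1 p.2 / ((p.1 : ℝ) ^ (-β₁) * (p.2 : ℝ) ^ (-β₂) * Real.log p.1 * Real.log p.2))
      (atTop ×ˢ atTop)
      (nhds ((1 : ℝ))) := by
  have hββ : β₂ = β₁ := by rw [hβ₁, hβ₂]
  rw [hββ] at hc ⊢
  clear hββ hβ₂ β₂
  have hβ1 : 1 ≤ β₁ := by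
    rw [hβ₁, le_div_iff₀ (by linarith)]; linarith
  obtain ⟨C, hC0, hC⟩ := w_bdd w hA1 winf (fun i => (hA2 i).1) wco (fun i => (hA3 i).1)
  obtain ⟨D, hD0, hD⟩ := w_bdd (fun i j => (w i j)⁻¹)
    (by simpa using hA1.inv₀ one_ne_zero)
    (fun i => (winf i)⁻¹) (fun i => (hA2 i).1.inv₀ (hA2 i).2.ne')
    (fun i => (wco i)⁻¹) (fun i => (hA3 i).1.inv₀ (hA3 i).2.ne')
  have main : ∀ δ : ℝ, 0 < δ → ∃ K : ℝ, 0 ≤ K ∧ ∀ n m : ℕ, 1 ≤ n → 1 ≤ m →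
      |(n:ℝ) ^ β₁ * (m:ℝ) ^ β₁ * ρ n m - GG β₁ n * GG β₁ m| ≤
        δ * (GG β₁ n * GG β₁ m) + K * (GG β₁ n + GG β₁ m) := by
    intro δ hδ
    obtain ⟨K, N, hK, hb⟩ := key_bound α β₁ hα hα2 hβ₁ hβ1 w hw hA1 C hC0 hC D hD0 hD δ hδ
    refine ⟨K * (N + 1), by positivity, ?_⟩
    intro n m hn hm
    have hs := hsum n m hn hm
    have e : (n:ℝ) ^ β₁ * (m:ℝ) ^ β₁ * ρ n m =
        ∑' q : ℕ × ℕ, (n:ℝ) ^ β₁ * (m:ℝ) ^ β₁ * V α (c q.1 q.2) (c (q.1 + n) (q.2 + m)) := by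
      rw [tsum_mul_left, hρ n m hn hm, hs.tsum_prod]
    rw [e]
    refine (sum_bound β₁ hβ1 δ K N n m hδ hK _ (hs.mul_left _) ?_).trans ?_
    · intro i j
      simp only [hc]
      exact hb n m i j hn hm
    · have b1 := GG_nonneg β₁ n
      have b2 := GG_nonneg β₁ m
      have : 0 ≤ K * GG β₁ n := by positivity
      nlinarith
  have hx := GG_tendsto hβ1
  have hl : Tendsto (fun n : ℕ => (Real.log n)⁻¹) atTop (𝓝 0) :=
    (Real.tendsto_log_atTop.comp tendsto_natCast_atTop_atTop).inv_tendsto_atTop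
  have f1 : Tendsto (fun p : ℕ × ℕ => p.1) (atTop ×ˢ atTop) atTop := tendsto_fst
  have f2 : Tendsto (fun p : ℕ × ℕ => p.2) (atTop ×ˢ atTop) atTop := tendsto_snd
  have x1 := hx.comp f1
  have x2 := hx.comp f2
  have l1 := hl.comp f1
  have l2 := hl.comp f2
  have xx := x1.mul x2
  rw [Metric.tendsto_nhds]
  intro ε hε
  obtain ⟨K, hK, hb⟩ := main (ε / 4) (by linarith)
  have U := ((xx.const_mul (ε / 4)).add (((x1.mul l2).add (x2.mul l1)).const_mul K)).add ((xx.sub_const 1).abs)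
  have U2 := U.eventually_lt_const (u := ε) (by norm_num; linarith)
  filter_upwards [U2, f1.eventually (eventually_ge_atTop 2), f2.eventually (eventually_ge_atTop 2)] with p hp h1 h2
  obtain ⟨n, m⟩ := p
  simp only [Function.comp] at hp h1 h2 ⊢
  refine lt_of_le_of_lt ?_ hp
  have hn : (0:ℝ) < n := by exact_mod_cast (by omega : 0 < n)
  have hm : (0:ℝ) < m := by exact_mod_cast (by omega : 0 < m)
  have ln : 0 < Real.log n := Real.log_pos (by exact_mod_cast h1)
  have lm : 0 < Real.log m := Real.log_pos (by exact_mod_cast h2)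
  have hb' := hb n m (by omega) (by omega)
  rw [Real.dist_eq]
  have e : ρ n m / ((n:ℝ) ^ (-β₁) * (m:ℝ) ^ (-β₁) * Real.log n * Real.log m) - 1 =
      ((n:ℝ) ^ β₁ * (m:ℝ) ^ β₁ * ρ n m - GG β₁ n * GG β₁ m) / (Real.log n * Real.log m) +
      (GG β₁ n / Real.log n * (GG β₁ m / Real.log m) - 1) := by
    rw [Real.rpow_neg hn.le, Real.rpow_neg hm.le]
    have := (Real.rpow_pos_of_pos hn β₁).ne'
    have := (Real.rpow_pos_of_pos hm β₁).ne'
    field_simp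
    ring
  rw [e]
  refine (abs_add_le _ _).trans ?_
  gcongr
  rw [abs_div, abs_of_pos (mul_pos ln lm), div_le_iff₀ (mul_pos ln lm)]
  refine hb'.trans (le_of_eq ?_)
  field_simp
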